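/- arXiv:2212.13250 — 5 statements merged into one kernel-verified Lean document; each statement's English description precedes it below -/
import Mathlib

section
/- Minimax theorem for finite parameter spaces: suppose the parameter space Θ is a nonempty finite set (with the powerset σ-algebra). Then inf_{δ ∈ 𝒟} sup_{θ ∈ Θ} r(θ,δ) = sup_{π} inf_{δ ∈ 𝒟} Σ_{θ ∈ Θ} π(θ)·r(θ,δ), where the supremum on the right ranges over all probability mass functions π on Θ and both sides are computed in [0,∞]. Moreover, the supremum is attained: there exists a least favorable prior, i.e., a probability mass function π₀ on Θ with inf_{δ ∈ 𝒟} Σ_{θ} π₀(θ)·r(θ,δ) = sup_{π} inf_{δ ∈ 𝒟} Σ_{θ} π(θ)·r(θ,δ). -/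
open MeasureTheory ProbabilityTheory

/-- The risk of a randomized decision procedure (Markov kernel) `δ` at parameter `θ`:
`r(θ,δ) = ∫_X (∫_A ℓ(θ,a) δ(x)(da)) P_θ(dx)`, valued in `[0,∞]`. -/
noncomputable def risk {Θ X A : Type*} [MeasurableSpace X] [MeasurableSpace A]
    (ℓ : Θ → A → NNReal) (P : Θ → Measure X) (δ : Kernel X A) (θ : Θ) : ENNReal :=
  ∫⁻ x, ∫⁻ a, (ℓ θ a : ENNReal) ∂(δ x) ∂(P θ)

/-- A convex upper set in `ℝ^Θ` avoiding the open orthant below `(V, …, V)` is separated from it by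
a probability vector. -/
lemma exists_stdSimplex_le_of_convex {Θ : Type*} [Fintype Θ]
    {R : Set (Θ → ℝ)} (hconv : Convex ℝ R) (hup : IsUpperSet R) (hne : R.Nonempty) {V : ℝ}
    (hV : ∀ v ∈ R, ∃ θ, V ≤ v θ) :
    ∃ w ∈ stdSimplex ℝ Θ, ∀ v ∈ R, V ≤ ∑ θ, w θ * v θ := by
  classical
  have hs : {y : Θ → ℝ | ∀ θ, y θ < V} = Set.univ.pi fun _ => Set.Iio V := by
    ext y; simp
  have hsc : Convex ℝ {y : Θ → ℝ | ∀ θ, y θ < V} := by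
    rw [hs]; exact convex_pi fun _ _ => convex_Iio V
  have hso : IsOpen {y : Θ → ℝ | ∀ θ, y θ < V} := by
    rw [hs]; exact isOpen_set_pi Set.finite_univ fun _ _ => isOpen_Iio
  have hd : Disjoint {y : Θ → ℝ | ∀ θ, y θ < V} R := by
    rw [Set.disjoint_left]
    intro y hy hyR
    obtain ⟨θ, hθ⟩ := hV y hyR
    exact (hy θ).not_ge hθ
  obtain ⟨f, u, hf1, hf2⟩ := geometric_hahn_banach_open hsc hso hconv hd
  have hf : ∀ v : Θ → ℝ, f v = ∑ θ, f (Pi.single θ 1) * v θ := by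
    intro v
    conv_lhs => rw [pi_eq_sum_univ' v]
    simp only [map_sum, map_smul, smul_eq_mul]
    refine Finset.sum_congr rfl fun θ _ => ?_
    rw [mul_comm]
  set w : Θ → ℝ := fun θ => f (Pi.single θ 1)
  obtain ⟨v₀, hv₀⟩ := hne
  have hw0 : ∀ θ, 0 ≤ w θ := by
    intro θ
    by_contra! hneg
    set c : ℝ := (f v₀ - u + 1) / (-w θ) with hc
    have hc0 : 0 ≤ c := div_nonneg (by linarith [hf2 v₀ hv₀]) (by linarith)
    have hmem : v₀ + c • Pi.single θ (1 : ℝ) ∈ R := by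
      refine hup ?_ hv₀
      refine le_add_of_nonneg_right (smul_nonneg hc0 ?_)
      exact Pi.single_nonneg.2 zero_le_one
    have h1 := hf2 _ hmem
    rw [map_add, map_smul, smul_eq_mul] at h1
    have h2 : c * w θ = -(f v₀ - u + 1) := by
      rw [hc, div_neg, neg_mul, div_mul_cancel₀ _ hneg.ne]
    change u ≤ f v₀ + c * w θ at h1
    linarith
  have hW : ∀ a : ℝ, a < V → a * ∑ θ, w θ < u := by
    intro a ha
    have h := hf1 (fun _ => a) fun _ => ha
    rwa [hf, ← Finset.sum_mul, mul_comm] at h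
  have hWpos : 0 < ∑ θ, w θ := by
    refine (Finset.sum_nonneg fun θ _ => hw0 θ).lt_of_ne fun h0 => ?_
    have h1 := hW (V - 1) (by linarith)
    have h2 := hf2 v₀ hv₀
    have hz := (Finset.sum_eq_zero_iff_of_nonneg fun θ _ => hw0 θ).1 h0.symm
    have h3 : f v₀ = 0 := by
      rw [hf]
      exact Finset.sum_eq_zero fun θ hθ => by
        rw [show f (Pi.single θ 1) = 0 from hz θ hθ, zero_mul]
    rw [← h0] at h1
    linarith
  have hVu : V ≤ u / ∑ θ, w θ :=
    le_of_forall_lt fun a ha => (lt_div_iff₀ hWpos).2 (hW a ha)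
  refine ⟨fun θ => w θ / ∑ θ, w θ, ⟨fun θ => div_nonneg (hw0 θ) hWpos.le, ?_⟩, fun v hv => ?_⟩
  · rw [← Finset.sum_div, div_self hWpos.ne']
  · refine hVu.trans ?_
    have h := hf2 v hv
    rw [hf] at h
    simp only [div_mul_eq_mul_div]
    rw [← Finset.sum_div]
    exact div_le_div_of_nonneg_right h hWpos.le

section

variable {Θ X A : Type*} [MeasurableSpace X] [MeasurableSpace A]

lemma exists_isMarkovKernel_convexComb (δ₁ δ₂ : Kernel X A) [IsMarkovKernel δ₁]
    [IsMarkovKernel δ₂] {s t : ENNReal} (hst : s + t = 1) :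
    ∃ κ : Kernel X A, IsMarkovKernel κ ∧ ∀ x, κ x = s • δ₁ x + t • δ₂ x := by
  refine ⟨⟨fun x => s • δ₁ x + t • δ₂ x, ?_⟩, ⟨fun x => ⟨?_⟩⟩, fun x => rfl⟩
  · refine Measure.measurable_of_measurable_coe _ fun B hB => ?_
    simp only [Measure.coe_add, Measure.coe_smul, Pi.add_apply, Pi.smul_apply, smul_eq_mul]
    exact ((δ₁.measurable_coe hB).const_mul s).add ((δ₂.measurable_coe hB).const_mul t)
  · change (s • δ₁ x + t • δ₂ x) Set.univ = 1
    simp [hst]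

/-- Follow `δ` as long as the action lies in `B`, and switch to `δ₀` otherwise. -/
lemma exists_isMarkovKernel_splice (δ δ₀ : Kernel X A) [IsMarkovKernel δ] [IsMarkovKernel δ₀]
    {B : Set A} (hB : MeasurableSet B) :
    ∃ κ : Kernel X A, IsMarkovKernel κ ∧ ∀ x, κ x = (δ x).restrict B + δ x Bᶜ • δ₀ x := by
  refine ⟨⟨fun x => (δ x).restrict B + δ x Bᶜ • δ₀ x, ?_⟩, ⟨fun x => ⟨?_⟩⟩, fun x => rfl⟩
  · refine Measure.measurable_of_measurable_coe _ fun C hC => ?_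
    simp only [Measure.coe_add, Measure.coe_smul, Pi.add_apply, Pi.smul_apply, smul_eq_mul,
      Measure.restrict_apply hC]
    exact (δ.measurable_coe (hC.inter hB)).add
      ((δ.measurable_coe hB.compl).mul (δ₀.measurable_coe hC))
  · change ((δ x).restrict B + δ x Bᶜ • δ₀ x) Set.univ = 1
    simp [measure_add_measure_compl hB]

lemma measurable_lintegral_loss {ℓ : Θ → A → NNReal} {θ : Θ} (hℓ : Measurable (ℓ θ))
    (δ : Kernel X A) : Measurable fun x => ∫⁻ a, (ℓ θ a : ENNReal) ∂(δ x) :=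
  hℓ.coe_nnreal_ennreal.lintegral_kernel

lemma risk_convexComb {ℓ : Θ → A → NNReal} {θ : Θ} (hℓ : Measurable (ℓ θ)) (P : Θ → Measure X)
    {κ δ₁ δ₂ : Kernel X A} {s t : ENNReal} (hκ : ∀ x, κ x = s • δ₁ x + t • δ₂ x) :
    risk ℓ P κ θ = s * risk ℓ P δ₁ θ + t * risk ℓ P δ₂ θ := by
  have h₁ := measurable_lintegral_loss hℓ δ₁
  have h₂ := measurable_lintegral_loss hℓ δ₂
  simp only [risk, hκ, lintegral_add_measure, lintegral_smul_measure, smul_eq_mul]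
  rw [lintegral_add_left (h₁.const_mul s), lintegral_const_mul _ h₁, lintegral_const_mul _ h₂]

/-- If some procedure has finite risk everywhere, then every procedure is approximated from above
by procedures with everywhere finite risk. -/
lemma exists_finite_risk_approx [Fintype Θ] {ℓ : Θ → A → NNReal}
    (hℓ : ∀ θ, Measurable (ℓ θ)) {P : Θ → Measure X} (hP : ∀ θ, IsProbabilityMeasure (P θ))
    (δ δ₀ : Kernel X A) [IsMarkovKernel δ] [IsMarkovKernel δ₀]
    (h₀ : ∀ θ, risk ℓ P δ₀ θ ≠ ⊤) :
    ∃ (κ : ℕ → Kernel X A) (ε : ℕ → Θ → ENNReal), (∀ n, IsMarkovKernel (κ n)) ∧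
      (∀ n θ, risk ℓ P (κ n) θ ≠ ⊤) ∧ (∀ n θ, risk ℓ P (κ n) θ ≤ risk ℓ P δ θ + ε n θ) ∧
      ∀ θ, Filter.Tendsto (fun n => ε n θ) Filter.atTop (nhds 0) := by
  set B : ℕ → Set A := fun n => ⋂ θ, {a | ℓ θ a ≤ n}
  have hB : ∀ n, MeasurableSet (B n) := fun n =>
    MeasurableSet.iInter fun θ => measurableSet_le (hℓ θ) measurable_const
  choose κ hκM hκ using fun n => exists_isMarkovKernel_splice δ δ₀ (hB n)
  set ε : ℕ → Θ → ENNReal := fun n θ =>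
    ∫⁻ x, δ x (B n)ᶜ * ∫⁻ a, (ℓ θ a : ENNReal) ∂(δ₀ x) ∂(P θ) with hε
  have hrisk : ∀ n θ, risk ℓ P (κ n) θ
      = ∫⁻ x, ∫⁻ a in B n, (ℓ θ a : ENNReal) ∂(δ x) ∂(P θ) + ε n θ := by
    intro n θ
    simp only [risk, hκ, lintegral_add_measure, lintegral_smul_measure, smul_eq_mul, hε]
    exact lintegral_add_right _
      ((δ.measurable_coe (hB n).compl).mul (measurable_lintegral_loss (hℓ θ) δ₀))
  have hεle : ∀ n θ, ε n θ ≤ risk ℓ P δ₀ θ := fun n θ =>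
    lintegral_mono fun x => mul_le_of_le_one_left' prob_le_one
  refine ⟨κ, ε, hκM, fun n θ => ?_, fun n θ => ?_, fun θ => ?_⟩
  · rw [hrisk]
    have hle : ∫⁻ x, ∫⁻ a in B n, (ℓ θ a : ENNReal) ∂(δ x) ∂(P θ) ≤ n := by
      calc ∫⁻ x, ∫⁻ a in B n, (ℓ θ a : ENNReal) ∂(δ x) ∂(P θ)
          ≤ ∫⁻ x, (n : ENNReal) ∂(P θ) := by
            refine lintegral_mono fun x => ?_
            calc ∫⁻ a in B n, (ℓ θ a : ENNReal) ∂(δ x)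
                ≤ ∫⁻ a in B n, (n : ENNReal) ∂(δ x) := by
                  refine setLIntegral_mono measurable_const fun a ha => ?_
                  have h : ℓ θ a ≤ n := Set.mem_iInter.1 ha θ
                  exact_mod_cast h
              _ = n * δ x (B n) := by simp
              _ ≤ n := mul_le_of_le_one_right' prob_le_one
        _ = n := by simp
    exact ENNReal.add_ne_top.2 ⟨ne_top_of_le_ne_top (ENNReal.natCast_ne_top n) hle,
      ne_top_of_le_ne_top (h₀ θ) (hεle n θ)⟩
  · rw [hrisk]
    gcongr
    exact lintegral_mono fun x => setLIntegral_le_lintegral _ _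
  · have hfin : ∀ᵐ x ∂(P θ), ∫⁻ a, (ℓ θ a : ENNReal) ∂(δ₀ x) < ⊤ :=
      ae_lt_top (measurable_lintegral_loss (hℓ θ) δ₀) (h₀ θ)
    have hanti : Antitone fun n => (B n)ᶜ := fun m n hmn =>
      Set.compl_subset_compl.2 (Set.iInter_mono fun θ a (ha : ℓ θ a ≤ m) =>
        show ℓ θ a ≤ n from ha.trans (Nat.cast_le.2 hmn))
    have hempty : ⋂ n, (B n)ᶜ = ∅ := by
      rw [← Set.compl_iUnion, Set.compl_empty_iff, Set.eq_univ_iff_forall]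
      intro a
      obtain ⟨n, hn⟩ := exists_nat_ge (∑ θ, ℓ θ a)
      refine Set.mem_iUnion.2 ⟨n, Set.mem_iInter.2 fun θ => ?_⟩
      exact (Finset.single_le_sum (f := fun θ => ℓ θ a) (fun _ _ => zero_le)
        (Finset.mem_univ θ)).trans hn
    have h := tendsto_lintegral_of_dominated_convergence (μ := P θ)
      (F := fun n x => δ x (B n)ᶜ * ∫⁻ a, (ℓ θ a : ENNReal) ∂(δ₀ x)) (f := fun _ => 0)
      (fun x => ∫⁻ a, (ℓ θ a : ENNReal) ∂(δ₀ x))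
      (fun n => (δ.measurable_coe (hB n).compl).mul (measurable_lintegral_loss (hℓ θ) δ₀))
      (fun n => Filter.Eventually.of_forall fun x => mul_le_of_le_one_left' prob_le_one)
      (h₀ θ) (by
        filter_upwards [hfin] with x hx
        have h1 := tendsto_measure_iInter_atTop (μ := δ x)
          (fun n => (hB n).compl.nullMeasurableSet) hanti ⟨0, measure_ne_top _ _⟩
        rw [hempty, measure_empty] at h1
        simpa using ENNReal.Tendsto.mul_const h1 (Or.inr hx.ne))
    simpa using h

/-- Risk vectors dominating the risk of some procedure. -/
def riskUpperSet (ℓ : Θ → A → NNReal) (P : Θ → Measure X) : Set (Θ → ℝ) :=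
  {v | 0 ≤ v ∧ ∃ δ : Kernel X A, IsMarkovKernel δ ∧ ∀ θ, risk ℓ P δ θ ≤ ENNReal.ofReal (v θ)}

lemma isUpperSet_riskUpperSet (ℓ : Θ → A → NNReal) (P : Θ → Measure X) :
    IsUpperSet (riskUpperSet ℓ P) := by
  rintro v v' hvv' ⟨hv, δ, hδ, hr⟩
  exact ⟨hv.trans hvv', δ, hδ, fun θ => (hr θ).trans (ENNReal.ofReal_le_ofReal (hvv' θ))⟩

lemma convex_riskUpperSet {ℓ : Θ → A → NNReal} (hℓ : ∀ θ, Measurable (ℓ θ))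
    (P : Θ → Measure X) : Convex ℝ (riskUpperSet ℓ P) := by
  rintro v ⟨hv, δ, hδ, hr⟩ v' ⟨hv', δ', hδ', hr'⟩ s t hs ht hst
  refine ⟨add_nonneg (smul_nonneg hs hv) (smul_nonneg ht hv'), ?_⟩
  obtain ⟨κ, hκM, hκ⟩ := exists_isMarkovKernel_convexComb δ δ'
    (s := ENNReal.ofReal s) (t := ENNReal.ofReal t)
    (by rw [← ENNReal.ofReal_add hs ht, hst, ENNReal.ofReal_one])
  refine ⟨κ, hκM, fun θ => ?_⟩
  rw [risk_convexComb (hℓ θ) P hκ]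
  simp only [Pi.add_apply, Pi.smul_apply, smul_eq_mul]
  rw [ENNReal.ofReal_add (mul_nonneg hs (hv θ)) (mul_nonneg ht (hv' θ)),
    ENNReal.ofReal_mul hs, ENNReal.ofReal_mul ht]
  gcongr
  exacts [hr θ, hr' θ]

/-- A prior whose Bayes risk is at least the minimax risk. -/
lemma exists_prior_minimax_le [Fintype Θ] [Nonempty Θ] {ℓ : Θ → A → NNReal}
    (hℓ : ∀ θ, Measurable (ℓ θ)) {P : Θ → Measure X} (hP : ∀ θ, IsProbabilityMeasure (P θ)) :
    ∃ π : PMF Θ, ∀ δ : {δ : Kernel X A // IsMarkovKernel δ},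
      (⨅ δ : {δ : Kernel X A // IsMarkovKernel δ}, ⨆ θ : Θ, risk ℓ P δ.1 θ)
        ≤ ∑ θ, π θ * risk ℓ P δ.1 θ := by
  by_cases hfin : ∃ δ₀ : Kernel X A, IsMarkovKernel δ₀ ∧ ∀ θ, risk ℓ P δ₀ θ ≠ ⊤
  swap
  · push Not at hfin
    refine ⟨PMF.uniformOfFintype Θ, fun δ => ?_⟩
    obtain ⟨θ, hθ⟩ := hfin δ.1 δ.2
    refine le_top.trans (ENNReal.sum_eq_top.2 ⟨θ, Finset.mem_univ θ, ?_⟩).ge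
    rw [hθ]
    exact ENNReal.mul_top (by simp)
  obtain ⟨δ₀, hδ₀, h₀⟩ := hfin
  set V := ⨅ δ : {δ : Kernel X A // IsMarkovKernel δ}, ⨆ θ : Θ, risk ℓ P δ.1 θ with hVdef
  have hVtop : V ≠ ⊤ := by
    refine ne_top_of_le_ne_top ?_ (iInf_le _ ⟨δ₀, hδ₀⟩)
    obtain ⟨θ, hθ⟩ := exists_eq_ciSup_of_finite (f := fun θ => risk ℓ P δ₀ θ)
    exact hθ ▸ h₀ θ
  have hVle : ∀ v ∈ riskUpperSet ℓ P, ∃ θ, V.toReal ≤ v θ := by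
    rintro v ⟨hv, δ, hδ, hr⟩
    obtain ⟨θ, hθ⟩ := Finite.exists_max v
    refine ⟨θ, ENNReal.toReal_le_of_le_ofReal (hv θ) ?_⟩
    refine (iInf_le _ ⟨δ, hδ⟩).trans (iSup_le fun θ' => (hr θ').trans ?_)
    exact ENNReal.ofReal_le_ofReal (hθ θ')
  have hmem : ∀ δ : Kernel X A, IsMarkovKernel δ → (∀ θ, risk ℓ P δ θ ≠ ⊤) →
      (fun θ => (risk ℓ P δ θ).toReal) ∈ riskUpperSet ℓ P := fun δ hδ h =>
    ⟨fun θ => ENNReal.toReal_nonneg, δ, hδ, fun θ => (ENNReal.ofReal_toReal (h θ)).ge⟩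
  obtain ⟨w, ⟨hw0, hw1⟩, hw⟩ := exists_stdSimplex_le_of_convex (convex_riskUpperSet hℓ P)
    (isUpperSet_riskUpperSet ℓ P) ⟨_, hmem δ₀ hδ₀ h₀⟩ hVle
  have hfinle : ∀ δ : Kernel X A, IsMarkovKernel δ → (∀ θ, risk ℓ P δ θ ≠ ⊤) →
      V ≤ ∑ θ, ENNReal.ofReal (w θ) * risk ℓ P δ θ := by
    intro δ hδ h
    have h1 := ENNReal.ofReal_le_ofReal (hw _ (hmem δ hδ h))
    rw [ENNReal.ofReal_toReal hVtop, ENNReal.ofReal_sum_of_nonneg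
      fun θ _ => mul_nonneg (hw0 θ) ENNReal.toReal_nonneg] at h1
    simpa only [ENNReal.ofReal_mul (hw0 _), ENNReal.ofReal_toReal (h _)] using h1
  refine ⟨PMF.ofFintype (fun θ => ENNReal.ofReal (w θ)) ?_, ?_⟩
  · rw [← ENNReal.ofReal_sum_of_nonneg fun θ _ => hw0 θ, hw1, ENNReal.ofReal_one]
  rintro ⟨δ, hδ⟩
  simp only [PMF.ofFintype_apply]
  obtain ⟨κ, ε, hκM, hκfin, hκle, hε⟩ := exists_finite_risk_approx hℓ hP δ δ₀ h₀
  have hlim : Filter.Tendsto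
      (fun n => ∑ θ, ENNReal.ofReal (w θ) * (risk ℓ P δ θ + ε n θ)) Filter.atTop
      (nhds (∑ θ, ENNReal.ofReal (w θ) * risk ℓ P δ θ)) := by
    refine tendsto_finsetSum _ fun θ _ => ENNReal.Tendsto.const_mul ?_
      (Or.inr ENNReal.ofReal_ne_top)
    simpa using (hε θ).const_add (risk ℓ P δ θ)
  refine ge_of_tendsto' hlim fun n => (hfinle (κ n) (hκM n) (hκfin n)).trans ?_
  exact Finset.sum_le_sum fun θ _ => mul_le_mul_right (hκle n θ) _

end

/-- Minimax theorem for finite parameter spaces, with existence of a least favorable prior. -/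
theorem stmt0 {Θ X A : Type*} [Fintype Θ] [Nonempty Θ]
    [MeasurableSpace X] [MeasurableSpace A]
    (ℓ : Θ → A → NNReal) (hℓ : ∀ θ : Θ, Measurable (ℓ θ))
    (P : Θ → Measure X) (hP : ∀ θ : Θ, IsProbabilityMeasure (P θ)) :
    (⨅ δ : {δ : Kernel X A // IsMarkovKernel δ}, ⨆ θ : Θ, risk ℓ P δ.1 θ)
      = (⨆ π : PMF Θ, ⨅ δ : {δ : Kernel X A // IsMarkovKernel δ},
          ∑ θ : Θ, π θ * risk ℓ P δ.1 θ)
    ∧ ∃ π₀ : PMF Θ,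
        (⨅ δ : {δ : Kernel X A // IsMarkovKernel δ}, ∑ θ : Θ, π₀ θ * risk ℓ P δ.1 θ)
          = (⨆ π : PMF Θ, ⨅ δ : {δ : Kernel X A // IsMarkovKernel δ},
              ∑ θ : Θ, π θ * risk ℓ P δ.1 θ) := by
  have hweak : ∀ π : PMF Θ,
      (⨅ δ : {δ : Kernel X A // IsMarkovKernel δ}, ∑ θ : Θ, π θ * risk ℓ P δ.1 θ)
        ≤ ⨅ δ : {δ : Kernel X A // IsMarkovKernel δ}, ⨆ θ : Θ, risk ℓ P δ.1 θ := fun π =>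
    iInf_mono fun δ => by
      calc ∑ θ, π θ * risk ℓ P δ.1 θ ≤ ∑ θ, π θ * ⨆ θ : Θ, risk ℓ P δ.1 θ := by
            gcongr with θ
            exact le_iSup (fun θ => risk ℓ P δ.1 θ) θ
        _ = ⨆ θ : Θ, risk ℓ P δ.1 θ := by
            rw [← Finset.sum_mul, ← tsum_fintype (L := .unconditional Θ), π.tsum_coe, one_mul]
  obtain ⟨π₀, hπ₀⟩ := exists_prior_minimax_le hℓ hP
  have hle := le_iInf hπ₀
  refine ⟨le_antisymm ?_ (iSup_le hweak), π₀, le_antisymm ?_ ((iSup_le hweak).trans hle)⟩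
  · exact hle.trans (le_iSup (fun π : PMF Θ =>
      ⨅ δ : {δ : Kernel X A // IsMarkovKernel δ}, ∑ θ : Θ, π θ * risk ℓ P δ.1 θ) π₀)
  · exact le_iSup (fun π : PMF Θ =>
      ⨅ δ : {δ : Kernel X A // IsMarkovKernel δ}, ∑ θ : Θ, π θ * risk ℓ P δ.1 θ) π₀
end

section
/- Fix v ∈ ℝ and n ∈ ℕ, and let f₁, …, fₙ : Θ → [0,∞] be functions on a set Θ (thought of as the risk functions of finitely many decision procedures). Suppose that for every weight vector p in the standard simplex (i.e., p : Fin n → [0,∞) with Σᵢ pᵢ = 1) there exists θ ∈ Θ with Σᵢ pᵢ·fᵢ(θ) > v (the sum computed in [0,∞], compared with ENNReal.ofReal v). Then there exists a finite subset Θ₀ ⊆ Θ such that for every weight vector p in the standard simplex there exists θ ∈ Θ₀ with Σᵢ pᵢ·fᵢ(θ) > v. -/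
theorem lowerSemicontinuous_coe_mul_const (c : ENNReal) :
    LowerSemicontinuous fun x : NNReal => (x : ENNReal) * c := by
  by_cases hc : c = ⊤
  · subst hc
    intro x y hy
    have hx : x ≠ 0 := by
      rintro rfl
      simp at hy
    filter_upwards [isOpen_ne.mem_nhds hx] with z hz
    rw [ENNReal.mul_top (ENNReal.coe_ne_zero.2 hz)]
    exact lt_of_lt_of_le hy le_top
  · exact ((ENNReal.continuous_mul_const hc).comp ENNReal.continuous_coe).lowerSemicontinuous

theorem isCompact_setOf_sum_eq_one {ι : Type*} [Fintype ι] :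
    IsCompact {p : ι → NNReal | ∑ i, p i = 1} := by
  refine (isCompact_Icc (a := (0 : ι → NNReal)) (b := 1)).of_isClosed_subset
    (isClosed_eq (by fun_prop) continuous_const) fun p hp => ⟨fun _ => zero_le, fun i => ?_⟩
  exact (Finset.single_le_sum (fun _ _ => zero_le) (Finset.mem_univ i)).trans_eq hp

/-- If every convex combination of the risk functions `f₁, …, fₙ` exceeds `v` somewhere on `Θ`,
then there is a finite subset `Θ₀ ⊆ Θ` on which every convex combination already exceeds `v`. -/
theorem stmt1 {Θ : Type*} (v : ℝ) (n : ℕ) (f : Fin n → Θ → ENNReal)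
    (h : ∀ p : Fin n → NNReal, ∑ i, p i = 1 →
      ∃ θ : Θ, ENNReal.ofReal v < ∑ i, (p i : ENNReal) * f i θ) :
    ∃ Θ₀ : Finset Θ, ∀ p : Fin n → NNReal, ∑ i, p i = 1 →
      ∃ θ ∈ Θ₀, ENNReal.ofReal v < ∑ i, (p i : ENNReal) * f i θ := by
  have hopen (θ : Θ) :
      IsOpen {p : Fin n → NNReal | ENNReal.ofReal v < ∑ i, (p i : ENNReal) * f i θ} :=
    (lowerSemicontinuous_sum fun i _ =>
      LowerSemicontinuous.comp (lowerSemicontinuous_coe_mul_const (f i θ))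
        (continuous_apply i)).isOpen_preimage _
  obtain ⟨Θ₀, hΘ₀⟩ := isCompact_setOf_sum_eq_one.elim_finite_subcover _ hopen
    fun p hp => Set.mem_iUnion.2 (h p hp)
  exact ⟨Θ₀, fun p hp => by simpa using hΘ₀ hp⟩
end

section
/- In the decision problem with Θ = A = {1/n : n ∈ ℕ, n ≥ 1}: for every probability measure μ on A, the supremum over all countably additive probability measures π on Θ of the Bayes risk r(π,μ) = ∫_Θ (∫_A ℓ(θ,a) μ(da)) π(dθ) equals 1. -/
open MeasureTheory

/-- The parameter space (= action space) `Θ = A = {1/n : n ∈ ℕ, n ≥ 1}`. -/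
def Param : Type := {x : ℝ // ∃ n : ℕ, 0 < n ∧ x = 1 / (n : ℝ)}

/-- The real number underlying an element of `Param`. -/
def Param.toR (p : Param) : ℝ := Subtype.val p

/-- `Param` is a countable discrete measurable space: its σ-algebra is the powerset. -/
instance : MeasurableSpace Param := ⊤

/-- The loss: `ℓ(θ,a) = 1` if `θ < a`, `0` if `θ = a`, `-1` if `θ > a`. -/
noncomputable def loss (θ a : Param) : ℝ :=
  if θ.toR < a.toR then 1 else if θ.toR = a.toR then 0 else -1

instance : DiscreteMeasurableSpace Param := ⟨fun _ => trivial⟩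

instance : Countable Param := by
  have h : Function.Surjective
      (fun n : {n : ℕ // 0 < n} => (⟨1 / (n.1 : ℝ), n.1, n.2, rfl⟩ : Param)) := by
    rintro ⟨x, n, hn, rfl⟩
    exact ⟨⟨n, hn⟩, rfl⟩
  exact h.countable

theorem Param.toR_pos (p : Param) : 0 < p.toR := by
  obtain ⟨x, n, hn, rfl⟩ := p
  change (0 : ℝ) < 1 / n
  positivity

/-- The parameter `1 / (n + 1)`. -/
noncomputable def Param.oneDivSucc (n : ℕ) : Param :=
  ⟨1 / ((n + 1 : ℕ) : ℝ), n + 1, n.succ_pos, rfl⟩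

theorem Param.tendsto_toR_oneDivSucc :
    Filter.Tendsto (fun n => (oneDivSucc n).toR) Filter.atTop (nhds 0) := by
  simpa [oneDivSucc, toR] using tendsto_one_div_add_atTop_nhds_zero_nat (𝕜 := ℝ)

theorem norm_loss_le_one (θ a : Param) : ‖loss θ a‖ ≤ 1 := by
  unfold loss
  split_ifs <;> simp

theorem norm_integral_loss_le_one (μ : Measure Param) [IsProbabilityMeasure μ] (θ : Param) :
    ‖∫ a, loss θ a ∂μ‖ ≤ 1 := by
  simpa using norm_integral_le_of_norm_le_const (μ := μ)
    (Filter.Eventually.of_forall (norm_loss_le_one θ))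

theorem bayesRisk_le_one (μ π : Measure Param) [IsProbabilityMeasure μ]
    [IsProbabilityMeasure π] : ∫ θ, ∫ a, loss θ a ∂μ ∂π ≤ 1 := by
  have h := norm_integral_le_of_norm_le_const (μ := π)
    (Filter.Eventually.of_forall (norm_integral_loss_le_one μ))
  simp only [probReal_univ, mul_one] at h
  exact (Real.le_norm_self _).trans h

theorem tendsto_integral_loss_oneDivSucc (μ : Measure Param) [IsProbabilityMeasure μ] :
    Filter.Tendsto (fun n => ∫ a, loss (Param.oneDivSucc n) a ∂μ) Filter.atTop (nhds 1) := by
  have h : Filter.Tendsto (fun n => ∫ a, loss (Param.oneDivSucc n) a ∂μ) Filter.atTop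
      (nhds (∫ _, (1 : ℝ) ∂μ)) := by
    refine tendsto_integral_of_dominated_convergence (fun _ => 1)
      (fun n => (Measurable.of_discrete).aestronglyMeasurable) (integrable_const 1)
      (fun n => Filter.Eventually.of_forall (norm_loss_le_one _))
      (Filter.Eventually.of_forall fun a => tendsto_const_nhds.congr' ?_)
    filter_upwards [Param.tendsto_toR_oneDivSucc.eventually_lt_const a.toR_pos] with n hn
    exact (if_pos hn).symm
  simpa using h

/-- For every randomized procedure `μ` (a probability measure on `A`), the supremum over
all countably additive priors `π` of the Bayes risk `r(π,μ)` equals `1`. -/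
theorem stmt2 (μ : Measure Param) (hμ : IsProbabilityMeasure μ) :
    (⨆ π : {π : Measure Param // IsProbabilityMeasure π},
      ∫ θ, ∫ a, loss θ a ∂μ ∂π.1) = 1 := by
  have hbdd : BddAbove (Set.range fun π : {π : Measure Param // IsProbabilityMeasure π} =>
      ∫ θ, ∫ a, loss θ a ∂μ ∂π.1) := by
    refine ⟨1, ?_⟩
    rintro _ ⟨⟨π, hπ⟩, rfl⟩
    exact bayesRisk_le_one μ π
  apply le_antisymm
  · exact Real.iSup_le (fun ⟨π, hπ⟩ => bayesRisk_le_one μ π) zero_le_one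
  · refine le_of_tendsto' (tendsto_integral_loss_oneDivSucc μ) fun n => ?_
    have h := le_ciSup hbdd ⟨Measure.dirac (Param.oneDivSucc n), inferInstance⟩
    simpa only [integral_dirac] using h
end

section
/- Minimax theorem on compact parameter spaces: suppose Θ is a nonempty compact metric space with its Borel σ-algebra, the minimax value is finite (inf_{δ ∈ 𝒟} sup_{θ ∈ Θ} r(θ,δ) < ∞), and for every δ ∈ 𝒟 the risk function θ ↦ r(θ,δ) is upper semicontinuous on Θ (as a function into [0,∞]). Then inf_{δ ∈ 𝒟} sup_{θ ∈ Θ} r(θ,δ) = sup_{π} inf_{δ ∈ 𝒟} ∫⁻_Θ r(θ,δ) π(dθ), where π ranges over all Borel probability measures on Θ, and the supremum is attained: there exists a least favorable prior π₀ with inf_{δ ∈ 𝒟} ∫⁻_Θ r(θ,δ) π₀(dθ) = inf_{δ ∈ 𝒟} sup_{θ ∈ Θ} r(θ,δ). -/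
open MeasureTheory ProbabilityTheory

open Filter Topology

theorem exists_probabilityMeasure_forall_le_integral {Θ : Type*} [TopologicalSpace Θ] [T2Space Θ]
    [CompactSpace Θ] [MeasurableSpace Θ] [BorelSpace Θ]
    {K : Set C(Θ, ℝ)} (hconv : Convex ℝ K) (hne : K.Nonempty) (hup : IsUpperSet K)
    {v : ℝ} (hv : ∀ g ∈ K, ∃ θ, v ≤ g θ) :
    ∃ π : Measure Θ, IsProbabilityMeasure π ∧ ∀ g ∈ K, v ≤ ∫ θ, g θ ∂π := by
  let O : Set C(Θ, ℝ) := {g | Set.MapsTo g Set.univ (Set.Iio v)}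
  have hO : IsOpen O := ContinuousMap.isOpen_setOfPred_mapsTo isCompact_univ isOpen_Iio
  have hOconv : Convex ℝ O := fun f hf g hg a b ha hb hab θ hθ =>
    (convex_Iio v) (hf hθ) (hg hθ) ha hb hab
  have hdisj : Disjoint O K := by
    refine Set.disjoint_left.2 fun g hgO hgK => ?_
    obtain ⟨θ, hθ⟩ := hv g hgK
    exact absurd (hgO (Set.mem_univ θ)) (not_lt.2 hθ)
  obtain ⟨L, u, hLO, hLK⟩ := geometric_hahn_banach_open hOconv hO hconv hdisj
  obtain ⟨k, hk⟩ := hne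
  have hpos : ∀ p : C(Θ, ℝ), 0 ≤ p → 0 ≤ L p := by
    intro p hp
    by_contra! hneg
    obtain ⟨n, hn⟩ := exists_nat_gt ((L k - u) / (-L p))
    have hmem : k + (n : ℝ) • p ∈ K :=
      hup (le_add_of_nonneg_right (smul_nonneg n.cast_nonneg hp)) hk
    have h := hLK _ hmem
    rw [map_add, map_smul, smul_eq_mul] at h
    rw [div_lt_iff₀ (neg_pos.2 hneg)] at hn
    linarith
  have hconst : ∀ c < v, c * L 1 < u := by
    intro c hc
    have h := hLO (c • 1) (fun θ _ => by simpa using hc)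
    simpa using h
  have hL1 : 0 < L 1 := by
    refine (hpos 1 zero_le_one).lt_of_ne' fun h0 => ?_
    have h1 := hconst (v - 1) (by linarith)
    have h2 : 0 ≤ L (‖k‖ • 1 - k) := hpos _ fun θ => by
      simpa using (le_abs_self _).trans (k.norm_coe_le_norm θ)
    have h3 := hLK k hk
    rw [map_sub, map_smul, h0, smul_zero] at h2
    rw [h0, mul_zero] at h1
    linarith
  have hvu : v * L 1 ≤ u := by
    rw [← le_div_iff₀ hL1]
    exact le_of_forall_lt fun c hc => (lt_div_iff₀ hL1).2 (hconst c hc)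
  let Λ : CompactlySupportedContinuousMap Θ ℝ →ₚ[ℝ] ℝ := PositiveLinearMap.mk₀
    { toFun := fun f => L f.toContinuousMap
      map_add' := fun f g => L.map_add f.toContinuousMap g.toContinuousMap
      map_smul' := fun c f => L.map_smul c f.toContinuousMap }
    fun f hf => hpos f.toContinuousMap hf
  let μ := RealRMK.rieszMeasure Λ
  have hμ : ∀ g : C(Θ, ℝ), ∫ θ, g θ ∂μ = L g := fun g =>
    RealRMK.integral_rieszMeasure Λ (CompactlySupportedContinuousMap.continuousMapEquiv g)
  have : IsFiniteMeasure μ := by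
    refine ⟨?_⟩
    refine (RealRMK.rieszMeasure_le_of_eq_one Λ
      (f := CompactlySupportedContinuousMap.continuousMapEquiv 1) (fun _ => zero_le_one)
      isCompact_univ fun _ _ => rfl).trans_lt ENNReal.ofReal_lt_top
  have hμ1 : μ.real Set.univ = L 1 := by simpa using hμ 1
  have hμ0 : μ ≠ 0 := by
    rintro h
    simp [h] at hμ1
    exact hL1.ne hμ1
  have : NeZero μ := ⟨hμ0⟩
  refine ⟨(μ Set.univ)⁻¹ • μ, inferInstance, fun g hg => ?_⟩
  rw [integral_smul_measure, hμ, ENNReal.toReal_inv, ← measureReal_def, hμ1, smul_eq_mul,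
    inv_mul_eq_div, le_div_iff₀ hL1]
  exact hvu.trans (hLK g hg)

/-- A bounded upper semicontinuous function on a metric space is a pointwise limit from above of a
bounded sequence of continuous functions. -/
theorem UpperSemicontinuous.exists_continuousMap_tendsto {Θ : Type*} [PseudoMetricSpace Θ]
    {f : Θ → ℝ} (hf : UpperSemicontinuous f) {M : ℝ} (hM : ∀ θ, f θ ≤ M) :
    ∃ h : ℕ → C(Θ, ℝ), (∀ n θ, f θ ≤ h n θ) ∧ (∀ n θ, h n θ ≤ M) ∧
      ∀ θ, Tendsto (fun n => h n θ) atTop (𝓝 (f θ)) := by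
  have hle : ∀ (n : ℕ) (θ y : Θ), f y - n * dist θ y ≤ M := fun n θ y => by
    have := hM y
    have : 0 ≤ n * dist θ y := by positivity
    linarith
  have hbdd : ∀ (n : ℕ) (θ : Θ), BddAbove (Set.range fun y => f y - n * dist θ y) :=
    fun n θ => ⟨M, Set.forall_mem_range.2 (hle n θ)⟩
  have hlip : ∀ n : ℕ, LipschitzWith n fun θ => ⨆ y, (f y - n * dist θ y) := by
    refine fun n => LipschitzWith.of_le_add_mul _ fun x z => ?_
    have : Nonempty Θ := ⟨x⟩
    refine ciSup_le fun y => ?_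
    have h1 := le_ciSup (hbdd n z) y
    have h2 : (n : ℝ) * dist z y ≤ n * (dist x y + dist x z) := by
      gcongr
      rw [add_comm, dist_comm x z]
      exact dist_triangle _ _ _
    simp only [NNReal.coe_natCast]
    linarith
  have hge : ∀ (n : ℕ) (θ : Θ), f θ ≤ ⨆ y, (f y - n * dist θ y) := fun n θ => by
    simpa using le_ciSup (hbdd n θ) θ
  refine ⟨fun n => ⟨_, (hlip n).continuous⟩, hge, fun n θ => ?_, fun θ => ?_⟩
  · have : Nonempty Θ := ⟨θ⟩
    exact ciSup_le (hle n θ)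
  · have : Nonempty Θ := ⟨θ⟩
    refine tendsto_order.2 ⟨fun a ha => .of_forall fun n => ha.trans_le (hge n θ), fun a ha => ?_⟩
    obtain ⟨b, hb, hba⟩ := exists_between ha
    obtain ⟨r, hr, hball⟩ := Metric.eventually_nhds_iff.1 (hf θ b hb)
    obtain ⟨N, hN⟩ := exists_nat_gt ((M - b) / r)
    filter_upwards [eventually_ge_atTop N] with n hn
    refine (ciSup_le fun y => ?_).trans_lt hba
    rcases lt_or_ge (dist y θ) r with hy | hy
    · have := hball hy
      have : 0 ≤ n * dist θ y := by positivity
      linarith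
    · rw [div_lt_iff₀ hr] at hN
      have h1 : (N : ℝ) * r ≤ n * dist θ y := by
        rw [dist_comm θ y]
        gcongr
      have := hM y
      linarith

theorem exists_probabilityMeasure_forall_le_lintegral {Θ : Type*} [MetricSpace Θ] [CompactSpace Θ]
    [Nonempty Θ] [MeasurableSpace Θ] [BorelSpace Θ] {F : Set (Θ → ENNReal)} (hne : F.Nonempty)
    (husc : ∀ f ∈ F, UpperSemicontinuous f) (hfin : ∀ f ∈ F, ∀ θ, f θ < ⊤)
    (hconv : Convex NNReal F) {V : ENNReal} (hVtop : V ≠ ⊤) (hV : ∀ f ∈ F, V ≤ ⨆ θ, f θ) :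
    ∃ π : Measure Θ, IsProbabilityMeasure π ∧ ∀ f ∈ F, V ≤ ∫⁻ θ, f θ ∂π := by
  have hmax : ∀ f ∈ F, ∃ θ₀, ∀ θ, f θ ≤ f θ₀ := fun f hf => by
    obtain ⟨θ₀, -, h⟩ := (husc f hf).upperSemicontinuousOn Set.univ |>.exists_isMaxOn
      Set.univ_nonempty isCompact_univ
    exact ⟨θ₀, fun θ => h (Set.mem_univ θ)⟩
  have happrox : ∀ f ∈ F, ∃ (M : ℝ) (h : ℕ → C(Θ, ℝ)), (∀ n θ, (f θ).toReal ≤ h n θ) ∧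
      (∀ n θ, h n θ ≤ M) ∧ ∀ θ, Tendsto (fun n => h n θ) atTop (𝓝 (f θ).toReal) := fun f hf => by
    obtain ⟨θ₀, hθ₀⟩ := hmax f hf
    refine ⟨(f θ₀).toReal, UpperSemicontinuous.exists_continuousMap_tendsto (fun θ y hy => ?_)
      fun θ => ENNReal.toReal_mono (hfin f hf θ₀).ne (hθ₀ θ)⟩
    filter_upwards [husc f hf θ _ ((ENNReal.lt_ofReal_iff_toReal_lt (hfin f hf θ).ne).2 hy)]
      with x hx
    exact (ENNReal.lt_ofReal_iff_toReal_lt (hfin f hf x).ne).1 hx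
  let K : Set C(Θ, ℝ) := {g | ∃ f ∈ F, ∀ θ, (f θ).toReal ≤ g θ}
  obtain ⟨π, hπ, hK⟩ := exists_probabilityMeasure_forall_le_integral (K := K) (v := V.toReal)
    (by
      rintro g ⟨f, hf, hfg⟩ g' ⟨f', hf', hfg'⟩ a b ha hb hab
      lift a to NNReal using ha
      lift b to NNReal using hb
      refine ⟨a • f + b • f', hconv hf hf' a.2 b.2 (by exact_mod_cast hab), fun θ => ?_⟩
      have h1 : (((a • f + b • f') θ).toReal) = a * (f θ).toReal + b * (f' θ).toReal := by
        simp only [Pi.add_apply, Pi.smul_apply, ENNReal.smul_def, smul_eq_mul]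
        rw [ENNReal.toReal_add (ENNReal.mul_ne_top ENNReal.coe_ne_top (hfin f hf θ).ne)
          (ENNReal.mul_ne_top ENNReal.coe_ne_top (hfin f' hf' θ).ne)]
        simp
      rw [h1]
      exact add_le_add (mul_le_mul_of_nonneg_left (hfg θ) a.2)
        (mul_le_mul_of_nonneg_left (hfg' θ) b.2))
    (by
      obtain ⟨f, hf⟩ := hne
      obtain ⟨M, h, hle, -⟩ := happrox f hf
      exact ⟨h 0, f, hf, hle 0⟩)
    (by
      rintro g g' hgg' ⟨f, hf, hfg⟩
      exact ⟨f, hf, fun θ => (hfg θ).trans (hgg' θ)⟩)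
    (by
      rintro g ⟨f, hf, hfg⟩
      obtain ⟨θ₀, hθ₀⟩ := hmax f hf
      exact ⟨θ₀, (ENNReal.toReal_mono (hfin f hf θ₀).ne
        ((hV f hf).trans (iSup_le hθ₀))).trans (hfg θ₀)⟩)
  refine ⟨π, hπ, fun f hf => ?_⟩
  obtain ⟨M, h, hle, hM, hlim⟩ := happrox f hf
  have key : Tendsto (fun n => ∫⁻ θ, ENNReal.ofReal (h n θ) ∂π) atTop (𝓝 (∫⁻ θ, f θ ∂π)) := by
    refine tendsto_lintegral_of_dominated_convergence (fun _ => ENNReal.ofReal M)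
      (fun n => (h n).continuous.measurable.ennreal_ofReal)
      (fun n => .of_forall fun θ => ENNReal.ofReal_le_ofReal (hM n θ)) (by simp)
      (.of_forall fun θ => ?_)
    simpa [ENNReal.ofReal_toReal (hfin f hf θ).ne] using ENNReal.tendsto_ofReal (hlim θ)
  refine ge_of_tendsto' key fun n => ?_
  rw [← ofReal_integral_eq_lintegral_ofReal]
  · exact ENNReal.le_ofReal_iff_toReal_le hVtop (integral_nonneg fun θ =>
      ENNReal.toReal_nonneg.trans (hle n θ)) |>.2 (hK _ ⟨f, hf, hle n⟩)
  · exact (h n).continuous.integrable_of_hasCompactSupport (HasCompactSupport.of_compactSpace _)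
  · exact .of_forall fun θ => ENNReal.toReal_nonneg.trans (hle n θ)

theorem exists_isMarkovKernel_lintegral_eq_mix {α β : Type*} [MeasurableSpace α]
    [MeasurableSpace β] (κ η : Kernel α β) [IsMarkovKernel κ] [IsMarkovKernel η]
    {w : α → ENNReal} (hw : Measurable w) (hw1 : ∀ x, w x ≤ 1) :
    ∃ ξ : Kernel α β, IsMarkovKernel ξ ∧ ∀ g : β → ENNReal, Measurable g → ∀ x,
      ∫⁻ y, g y ∂(ξ x) = w x * ∫⁻ y, g y ∂(κ x) + (1 - w x) * ∫⁻ y, g y ∂(η x) := by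
  have h : ∀ g : β → ENNReal, Measurable g → ∀ x,
      ∫⁻ y, g y ∂((κ.withDensity (fun x _ => w x) + η.withDensity (fun x _ => 1 - w x)) x)
        = w x * ∫⁻ y, g y ∂(κ x) + (1 - w x) * ∫⁻ y, g y ∂(η x) := fun g hg x => by
    rw [add_apply, lintegral_add_measure,
      Kernel.lintegral_withDensity κ (f := fun x _ => w x) (hw.comp measurable_fst) x hg,
      Kernel.lintegral_withDensity η (f := fun x _ => 1 - w x)
        ((hw.const_sub 1).comp measurable_fst) x hg,
      lintegral_const_mul _ hg, lintegral_const_mul _ hg]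
  refine ⟨_, ⟨fun x => ⟨?_⟩⟩, h⟩
  simpa [add_tsub_cancel_of_le (hw1 x)] using h 1 measurable_one x

section Risk

variable {Θ X A : Type*} [MeasurableSpace X] [MeasurableSpace A]
  {ℓ : Θ → A → NNReal} {P : Θ → Measure X}

theorem risk_eq_lintegral_bind (hℓ : ∀ θ, Measurable (ℓ θ)) (δ : Kernel X A) (θ : Θ) :
    risk ℓ P δ θ = ∫⁻ a, ℓ θ a ∂((P θ).bind δ) :=
  (Measure.lintegral_bind δ.aemeasurable (hℓ θ).coe_nnreal_ennreal.aemeasurable).symm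

theorem exists_risk_eq_convexCombination (hℓ : ∀ θ, Measurable (ℓ θ)) (δ η : Kernel X A)
    [IsMarkovKernel δ] [IsMarkovKernel η] {a b : NNReal} (hab : a + b = 1) :
    ∃ ξ : Kernel X A, IsMarkovKernel ξ ∧
      ∀ θ, risk ℓ P ξ θ = a * risk ℓ P δ θ + b * risk ℓ P η θ := by
  have hab' : (a : ENNReal) + b = 1 := by exact_mod_cast hab
  have hb : 1 - (a : ENNReal) = b := by
    rw [← hab', ENNReal.add_sub_cancel_left ENNReal.coe_ne_top]
  obtain ⟨ξ, hξ, h⟩ := exists_isMarkovKernel_lintegral_eq_mix δ η (w := fun _ => (a : ENNReal))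
    measurable_const fun _ => hab' ▸ le_self_add
  refine ⟨ξ, hξ, fun θ => ?_⟩
  have hm := (hℓ θ).coe_nnreal_ennreal
  simp only [risk, h _ hm, hb]
  rw [lintegral_add_left (hm.lintegral_kernel.const_mul _), lintegral_const_mul _
    hm.lintegral_kernel, lintegral_const_mul _ hm.lintegral_kernel]

theorem risk_const_dirac (hℓ : ∀ θ, Measurable (ℓ θ)) [∀ θ, IsProbabilityMeasure (P θ)]
    (a₀ : A) (θ : Θ) : risk ℓ P (Kernel.const X (Measure.dirac a₀)) θ = ℓ θ a₀ := by
  simp [risk, lintegral_dirac' _ (hℓ θ).coe_nnreal_ennreal]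

/-- The procedure that draws `a` from `δ` and then keeps it with probability `w a`, playing `a₀`
otherwise. -/
theorem exists_risk_eq_lintegral_truncation (hℓ : ∀ θ, Measurable (ℓ θ)) (δ : Kernel X A)
    [IsMarkovKernel δ] (a₀ : A) {w : A → ENNReal} (hw : Measurable w) (hw1 : ∀ a, w a ≤ 1) :
    ∃ ξ : Kernel X A, IsMarkovKernel ξ ∧ ∀ θ, risk ℓ P ξ θ
      = ∫⁻ a, (w a * ℓ θ a + (1 - w a) * ℓ θ a₀) ∂((P θ).bind δ) := by
  obtain ⟨κ, hκ, h⟩ := exists_isMarkovKernel_lintegral_eq_mix Kernel.id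
    (Kernel.const A (Measure.dirac a₀)) hw hw1
  refine ⟨κ ∘ₖ δ, inferInstance, fun θ => ?_⟩
  have hm := (hℓ θ).coe_nnreal_ennreal
  rw [Measure.lintegral_bind (f := fun a => w a * ℓ θ a + (1 - w a) * ℓ θ a₀) δ.aemeasurable
    ((hw.mul hm).add ((measurable_const.sub hw).mul measurable_const)).aemeasurable]
  simp [risk, Kernel.lintegral_comp _ _ _ hm, h _ hm, Kernel.id_apply, lintegral_dirac' _ hm]

variable [TopologicalSpace Θ] [CompactSpace Θ] [∀ θ, IsProbabilityMeasure (P θ)]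

/-- If all risk functions are upper semicontinuous, then for every procedure `δ` there is a strictly
positive weight making the risk finite everywhere. -/
theorem exists_weight_lintegral_lt_top (hℓ : ∀ θ, Measurable (ℓ θ))
    (husc : ∀ δ : Kernel X A, IsMarkovKernel δ → UpperSemicontinuous fun θ => risk ℓ P δ θ)
    (δ : Kernel X A) [IsMarkovKernel δ] (a₀ : A) :
    ∃ w : A → ENNReal, Measurable w ∧ (∀ a, 0 < w a) ∧ (∀ a, w a ≤ 1) ∧
      ∀ θ, ∫⁻ a, w a * ℓ θ a ∂((P θ).bind δ) < ⊤ := by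
  suffices h : ∃ w : A → ENNReal, Measurable w ∧ (∀ a, 0 < w a) ∧ (∀ a, w a ≤ 1) ∧
      ∀ θ ∈ Set.univ, ∫⁻ a, w a * ℓ θ a ∂((P θ).bind δ) < ⊤ by simpa using h
  refine isCompact_univ.induction_on ?_ (fun s t hst ht => ?_) (fun s t hs ht => ?_)
    fun θ₀ _ => ?_
  · exact ⟨1, measurable_one, by simp, by simp, by simp⟩
  · obtain ⟨w, hw, h0, h1, h⟩ := ht
    exact ⟨w, hw, h0, h1, fun θ hθ => h θ (hst hθ)⟩
  · obtain ⟨w, hw, h0, h1, h⟩ := hs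
    obtain ⟨w', hw', h0', h1', h'⟩ := ht
    refine ⟨fun a => min (w a) (w' a), hw.min hw', fun a => lt_min (h0 a) (h0' a),
      fun a => (min_le_left _ _).trans (h1 a), fun θ hθ => ?_⟩
    rcases hθ with hθ | hθ
    · refine (lintegral_mono fun a => ?_).trans_lt (h θ hθ)
      gcongr
      exact min_le_left _ _
    · refine (lintegral_mono fun a => ?_).trans_lt (h' θ hθ)
      gcongr
      exact min_le_right _ _
  · let w : A → ENNReal := fun a => (1 + (ℓ θ₀ a : ENNReal))⁻¹
    have hw : Measurable w := (measurable_const.add (hℓ θ₀).coe_nnreal_ennreal).inv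
    have hw1 : ∀ a, w a ≤ 1 := fun a => ENNReal.inv_le_one.2 le_self_add
    have hwℓ : ∀ a, w a * ℓ θ₀ a ≤ 1 := fun a => by
      rw [mul_comm, ← div_eq_mul_inv]
      exact ENNReal.div_le_of_le_mul (by simp)
    obtain ⟨ξ, hξ, hrisk⟩ := exists_risk_eq_lintegral_truncation (P := P) hℓ δ a₀ hw hw1
    have hlt : risk ℓ P ξ θ₀ < ⊤ := by
      rw [hrisk]
      refine (lintegral_mono (g := fun _ => 1 + (ℓ θ₀ a₀ : ENNReal)) fun a =>
        add_le_add (hwℓ a) (mul_le_of_le_one_left' tsub_le_self)).trans_lt ?_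
      simp
    refine ⟨_, mem_nhdsWithin_of_mem_nhds (husc ξ hξ θ₀ ⊤ hlt), w, hw, fun a => ?_, hw1,
      fun θ hθ => ?_⟩
    · exact ENNReal.inv_pos.2 (by simp)
    · refine (lintegral_mono fun a => le_self_add).trans_lt ((hrisk θ).symm.trans_lt hθ)

/-- A prior bound valid for all procedures with everywhere finite risk extends to all procedures. -/
theorem le_lintegral_risk_of_forall_lt_top [MeasurableSpace Θ] [BorelSpace Θ] [Nonempty Θ]
    (hℓ : ∀ θ, Measurable (ℓ θ))
    (husc : ∀ δ : Kernel X A, IsMarkovKernel δ → UpperSemicontinuous fun θ => risk ℓ P δ θ)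
    {π : Measure Θ} [IsProbabilityMeasure π] {V : ENNReal} (a₀ : A)
    (hV : ∀ δ : Kernel X A, IsMarkovKernel δ → (∀ θ, risk ℓ P δ θ < ⊤) →
      V ≤ ∫⁻ θ, risk ℓ P δ θ ∂π)
    (δ : Kernel X A) [IsMarkovKernel δ] : V ≤ ∫⁻ θ, risk ℓ P δ θ ∂π := by
  by_cases hδ : ∫⁻ θ, risk ℓ P δ θ ∂π = ⊤
  · simp [hδ]
  obtain ⟨θ₁, -, hθ₁⟩ := (husc (Kernel.const X (Measure.dirac a₀)) inferInstance
    |>.upperSemicontinuousOn Set.univ).exists_isMaxOn Set.univ_nonempty isCompact_univ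
  have hmax : ∀ θ, (ℓ θ a₀ : ENNReal) ≤ ℓ θ₁ a₀ := fun θ => by
    have := hθ₁ (Set.mem_univ θ)
    simpa only [Set.mem_ofPred_eq, risk_const_dirac hℓ] using this
  obtain ⟨w, hw, hw0, -, hwfin⟩ := exists_weight_lintegral_lt_top hℓ husc δ a₀
  let W : ℕ → A → ENNReal := fun n a => min 1 (n * w a)
  have hW : ∀ n, Measurable (W n) := fun n => measurable_const.min (hw.const_mul _)
  have hW1 : ∀ n a, W n a ≤ 1 := fun n a => min_le_left _ _
  choose ξ hξ hrisk using fun n =>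
    exists_risk_eq_lintegral_truncation (P := P) hℓ δ a₀ (hW n) (hW1 n)
  have hlast : ∀ n θ a, (1 - W n a) * (ℓ θ a₀ : ENNReal) ≤ ℓ θ a₀ := fun n θ a =>
    mul_le_of_le_one_left' tsub_le_self
  have hfirst : ∀ n θ a, W n a * (ℓ θ a : ENNReal) ≤ ℓ θ a := fun n θ a =>
    mul_le_of_le_one_left' (hW1 n a)
  have hξfin : ∀ n θ, risk ℓ P (ξ n) θ < ⊤ := fun n θ => by
    rw [hrisk]
    refine (lintegral_mono (g := fun a => n * (w a * ℓ θ a) + (ℓ θ a₀ : ENNReal)) fun a =>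
      add_le_add ?_ (hlast n θ a)).trans_lt ?_
    · rw [← mul_assoc]
      gcongr
      exact min_le_right _ _
    · rw [lintegral_add_right _ measurable_const,
        lintegral_const_mul (f := fun a => w a * ℓ θ a) _
          (hw.mul (hℓ θ).coe_nnreal_ennreal)]
      simpa using ENNReal.mul_lt_top (ENNReal.natCast_lt_top n) (hwfin θ)
  have hξle : ∀ n θ, risk ℓ P (ξ n) θ ≤ risk ℓ P δ θ + ℓ θ₁ a₀ := fun n θ => by
    rw [hrisk, risk_eq_lintegral_bind hℓ]
    refine (lintegral_mono (g := fun a => (ℓ θ a : ENNReal) + ℓ θ₁ a₀) fun a =>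
      add_le_add (hfirst n θ a) ((hlast n θ a).trans (hmax θ))).trans ?_
    rw [lintegral_add_right _ measurable_const]
    simp
  have hlimW : ∀ a, ∀ᶠ n in atTop, W n a = 1 := fun a => by
    obtain ⟨N, hN⟩ := ENNReal.exists_nat_mul_gt (hw0 a).ne' ENNReal.one_ne_top
    filter_upwards [eventually_ge_atTop N] with n hn
    refine min_eq_left (hN.le.trans ?_)
    gcongr
  have hlim : ∀ θ, risk ℓ P δ θ < ⊤ →
      Tendsto (fun n => risk ℓ P (ξ n) θ) atTop (𝓝 (risk ℓ P δ θ)) := fun θ hθ => by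
    simp only [hrisk]
    rw [risk_eq_lintegral_bind hℓ] at hθ ⊢
    have hm := (hℓ θ).coe_nnreal_ennreal
    refine tendsto_lintegral_of_dominated_convergence (fun a => (ℓ θ a : ENNReal) + ℓ θ a₀)
      (fun n => ((hW n).mul hm).add ((measurable_const.sub (hW n)).mul measurable_const))
      (fun n => .of_forall fun a => add_le_add (hfirst n θ a) (hlast n θ a)) ?_
      (.of_forall fun a => ?_)
    · rw [lintegral_add_right _ measurable_const]
      simpa using hθ.ne
    · refine tendsto_const_nhds.congr' ?_
      filter_upwards [hlimW a] with n hn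
      simp [hn]
  have hlimπ : Tendsto (fun n => ∫⁻ θ, risk ℓ P (ξ n) θ ∂π) atTop
      (𝓝 (∫⁻ θ, risk ℓ P δ θ ∂π)) := by
    refine tendsto_lintegral_of_dominated_convergence _ (fun n => (husc _ (hξ n)).measurable)
      (fun n => .of_forall (hξle n)) ?_ ?_
    · rw [lintegral_add_right _ measurable_const]
      simpa using hδ
    · filter_upwards [ae_lt_top (husc δ inferInstance).measurable hδ] with θ hθ
      exact hlim θ hθ
  exact ge_of_tendsto' hlimπ fun n => hV (ξ n) (hξ n) (hξfin n)

end Risk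

/-- Minimax theorem on a compact metric parameter space with upper semicontinuous risk
functions and finite minimax value, with existence of a least favorable prior. -/
theorem stmt7 {Θ X A : Type*} [MetricSpace Θ] [CompactSpace Θ] [Nonempty Θ]
    [MeasurableSpace Θ] [BorelSpace Θ] [MeasurableSpace X] [MeasurableSpace A]
    (ℓ : Θ → A → NNReal) (hℓ : ∀ θ : Θ, Measurable (ℓ θ))
    (P : Θ → Measure X) (hP : ∀ θ : Θ, IsProbabilityMeasure (P θ))
    (hfin : (⨅ δ : {δ : Kernel X A // IsMarkovKernel δ}, ⨆ θ : Θ, risk ℓ P δ.1 θ) < ⊤)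
    (husc : ∀ δ : Kernel X A, IsMarkovKernel δ →
      UpperSemicontinuous (fun θ : Θ => risk ℓ P δ θ)) :
    (⨅ δ : {δ : Kernel X A // IsMarkovKernel δ}, ⨆ θ : Θ, risk ℓ P δ.1 θ)
      = (⨆ π : {π : Measure Θ // IsProbabilityMeasure π},
          ⨅ δ : {δ : Kernel X A // IsMarkovKernel δ}, ∫⁻ θ, risk ℓ P δ.1 θ ∂π.1)
    ∧ ∃ π₀ : Measure Θ, IsProbabilityMeasure π₀ ∧
        (⨅ δ : {δ : Kernel X A // IsMarkovKernel δ}, ∫⁻ θ, risk ℓ P δ.1 θ ∂π₀)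
          = (⨅ δ : {δ : Kernel X A // IsMarkovKernel δ}, ⨆ θ : Θ, risk ℓ P δ.1 θ) := by
  have hgoal : ∃ π₀ : Measure Θ, IsProbabilityMeasure π₀ ∧
      ∀ δ : {δ : Kernel X A // IsMarkovKernel δ},
        (⨅ δ : {δ : Kernel X A // IsMarkovKernel δ}, ⨆ θ : Θ, risk ℓ P δ.1 θ)
          ≤ ∫⁻ θ, risk ℓ P δ.1 θ ∂π₀ := by
    obtain ⟨⟨δ₀, hδ₀⟩, -⟩ := iInf_lt_iff.1 hfin
    obtain ⟨x⟩ := nonempty_of_isProbabilityMeasure (P (Classical.arbitrary Θ))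
    obtain ⟨a₀⟩ := nonempty_of_isProbabilityMeasure (δ₀ x)
    obtain ⟨π, hπ, h⟩ := exists_probabilityMeasure_forall_le_lintegral
      (F := {f | ∃ δ : Kernel X A, IsMarkovKernel δ ∧ (∀ θ, risk ℓ P δ θ < ⊤) ∧ f = risk ℓ P δ})
      ⟨_, Kernel.const X (Measure.dirac a₀), inferInstance,
        fun θ => by simp [risk_const_dirac hℓ], rfl⟩
      (by rintro _ ⟨δ, hδ, -, rfl⟩; exact husc δ hδ)
      (by rintro _ ⟨δ, -, hδ, rfl⟩; exact hδ)
      (by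
        rintro _ ⟨δ, hδ, hδ', rfl⟩ _ ⟨η, hη, hη', rfl⟩ a b - - hab
        obtain ⟨ξ, hξ, h⟩ := exists_risk_eq_convexCombination (P := P) hℓ δ η hab
        refine ⟨ξ, hξ, fun θ => ?_, funext fun θ => (h θ).symm⟩
        rw [h]
        exact ENNReal.add_lt_top.2 ⟨ENNReal.mul_lt_top ENNReal.coe_lt_top (hδ' θ),
          ENNReal.mul_lt_top ENNReal.coe_lt_top (hη' θ)⟩)
      hfin.ne
      (by rintro _ ⟨δ, hδ, -, rfl⟩; exact iInf_le_of_le ⟨δ, hδ⟩ le_rfl)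
    refine ⟨π, hπ, fun ⟨δ, hδ⟩ => ?_⟩
    exact le_lintegral_risk_of_forall_lt_top hℓ husc a₀ (fun δ h1 h2 => h _ ⟨δ, h1, h2, rfl⟩) δ
  have hle : ∀ π : Measure Θ, IsProbabilityMeasure π →
      (⨅ δ : {δ : Kernel X A // IsMarkovKernel δ}, ∫⁻ θ, risk ℓ P δ.1 θ ∂π)
        ≤ ⨅ δ : {δ : Kernel X A // IsMarkovKernel δ}, ⨆ θ : Θ, risk ℓ P δ.1 θ :=
    fun π hπ => iInf_mono fun δ =>
      (lintegral_mono fun θ => le_iSup (risk ℓ P δ.1) θ).trans (by simp)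
  obtain ⟨π₀, hπ₀, h⟩ := hgoal
  exact ⟨le_antisymm (le_iSup_of_le ⟨π₀, hπ₀⟩ (le_iInf h)) (iSup_le fun π => hle π.1 π.2),
    π₀, hπ₀, le_antisymm (hle π₀ hπ₀) (le_iInf h)⟩
end

section
/- Least favorable sequences of finitely supported priors: suppose Θ is a nonempty totally bounded metric space with its Borel σ-algebra, A is nonempty, and there exists k ≥ 0 such that for every δ ∈ 𝒟 the risk function θ ↦ r(θ,δ) is a real-valued function that is Lipschitz with constant k on Θ. Then there exists a sequence (π_n)_{n ∈ ℕ} of finitely supported Borel probability measures on Θ (each π_n a finite convex combination of Dirac measures) such that lim_{n → ∞} inf_{δ ∈ 𝒟} ∫_Θ r(θ,δ) π_n(dθ) = inf_{δ ∈ 𝒟} sup_{θ ∈ Θ} r(θ,δ). -/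
open MeasureTheory ProbabilityTheory Filter

/-- If no point of a nonempty convex set of finite real vectors lies strictly below `c` in every
coordinate, then some probability vector has pairing at least `c` with the whole set. -/
theorem exists_mem_stdSimplex_forall_le_sum {ι : Type*} [Fintype ι] {V : Set (ι → ℝ)}
    (hV : Convex ℝ V) (hne : V.Nonempty) {c : ℝ} (hc : ∀ v ∈ V, ∃ i, c ≤ v i) :
    ∃ w ∈ stdSimplex ℝ ι, ∀ v ∈ V, c ≤ ∑ i, w i * v i := by
  classical
  have hopen : IsOpen {v : ι → ℝ | ∀ i, v i < c} := by
    rw [Set.ofPred_forall]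
    exact isOpen_iInter_of_finite fun i => isOpen_lt (continuous_apply i) continuous_const
  have hconv : Convex ℝ {v : ι → ℝ | ∀ i, v i < c} := by
    intro x hx y hy a b ha hb hab i
    exact convex_Iio (𝕜 := ℝ) c (hx i) (hy i) ha hb hab
  have hdisj : Disjoint {v : ι → ℝ | ∀ i, v i < c} V := by
    rw [Set.disjoint_left]
    intro v hv hvV
    obtain ⟨i, hi⟩ := hc v hvV
    exact absurd (hv i) (not_lt.2 hi)
  obtain ⟨f, u, hfu, huf⟩ := geometric_hahn_banach_open hconv hopen hV hdisj
  have hf : ∀ v : ι → ℝ, f v = ∑ i, v i * f (Pi.single i 1) := by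
    intro v
    conv_lhs => rw [pi_eq_sum_univ' v]
    simp [map_sum, smul_eq_mul, Pi.single]
  have hnonneg : ∀ i, 0 ≤ f (Pi.single i 1) := by
    intro i
    by_contra! hneg
    set b := f (fun _ => c - 1) with hb
    obtain ⟨n, hn⟩ := exists_nat_gt ((u - b) / (-f (Pi.single i 1)))
    rw [div_lt_iff₀ (by linarith)] at hn
    have h := hfu ((fun _ => c - 1) - (n : ℝ) • Pi.single i 1) (by
      intro j
      have : (0 : ℝ) ≤ (n : ℝ) * (Pi.single i 1 : ι → ℝ) j :=
        mul_nonneg n.cast_nonneg (by by_cases hij : j = i <;> simp [hij])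
      simp only [Pi.sub_apply, Pi.smul_apply, smul_eq_mul]
      linarith)
    rw [map_sub, map_smul, smul_eq_mul, ← hb] at h
    linarith
  set W := ∑ i, f (Pi.single i 1) with hW
  have hconst : ∀ t : ℝ, f (fun _ => t) = t * W := fun t => by
    rw [hf, hW, Finset.mul_sum]
  have hWpos : 0 < W := by
    refine lt_of_le_of_ne (Finset.sum_nonneg fun i _ => hnonneg i) fun h0 => ?_
    have hz := (Finset.sum_eq_zero_iff_of_nonneg fun i _ => hnonneg i).1 h0.symm
    obtain ⟨v, hv⟩ := hne
    have h1 := huf v hv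
    rw [hf, Finset.sum_eq_zero fun i hi => by rw [hz i hi, mul_zero]] at h1
    have h2 := hfu (fun _ => c - 1) fun _ => sub_one_lt c
    rw [hconst, ← h0, mul_zero] at h2
    linarith
  have hcW : c ≤ u / W := by
    refine le_of_forall_lt fun t ht => ?_
    rw [lt_div_iff₀ hWpos, ← hconst]
    exact hfu _ fun _ => ht
  refine ⟨fun i => f (Pi.single i 1) / W, ⟨fun i => div_nonneg (hnonneg i) hWpos.le, ?_⟩, ?_⟩
  · rw [← Finset.sum_div, div_self hWpos.ne']
  · intro v hv
    calc c ≤ u / W := hcW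
      _ ≤ f v / W := by gcongr; exact huf v hv
      _ = _ := by
        rw [hf, Finset.sum_div]
        exact Finset.sum_congr rfl fun i _ => by ring

/-- A real-valued Lipschitz function on a totally bounded space is bounded above. -/
theorem LipschitzWith.bddAbove_range_of_totallyBounded {Θ : Type*} [PseudoMetricSpace Θ]
    (hΘ : TotallyBounded (Set.univ : Set Θ)) {k : NNReal} {f : Θ → ℝ} (hf : LipschitzWith k f) :
    BddAbove (Set.range f) := by
  rw [← Set.image_univ]
  exact (hΘ.image hf.uniformContinuous).isBounded.bddAbove

/-- For a family of nonnegative, uniformly Lipschitz functions with convex range on a totally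
bounded space, some finitely supported prior attains the minimax value up to `ε`. -/
theorem exists_finite_prior_sub_le {Θ D : Type*} [MetricSpace Θ] [Nonempty Θ] [Nonempty D]
    [MeasurableSpace Θ] [BorelSpace Θ]
    (hΘ : TotallyBounded (Set.univ : Set Θ)) (k : NNReal) (R : D → Θ → ℝ)
    (hnonneg : ∀ d θ, 0 ≤ R d θ) (hLip : ∀ d, LipschitzWith k (R d))
    (hconv : Convex ℝ (Set.range R)) {ε : ℝ} (hε : 0 < ε) :
    ∃ π : Measure Θ, IsProbabilityMeasure π ∧
      (∃ s : Finset Θ, ∃ w : Θ → ENNReal, π = ∑ θ ∈ s, w θ • Measure.dirac θ) ∧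
      ∀ d, (⨅ d, ⨆ θ, R d θ) - ε ≤ ∫ θ, R d θ ∂π := by
  classical
  have hk : (0 : ℝ) < 2 * (k + 1) := by positivity
  obtain ⟨t, ht, htc⟩ := Metric.totallyBounded_iff.1 hΘ (ε / (2 * (k + 1))) (by positivity)
  lift t to Finset Θ using ht
  have hbelow : BddBelow (Set.range fun d => ⨆ θ, R d θ) :=
    ⟨0, by rintro _ ⟨d, rfl⟩; exact Real.iSup_nonneg (hnonneg d)⟩
  have hkey : ∀ d, ∃ i : t, (⨅ d, ⨆ θ, R d θ) - ε ≤ R d i := by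
    intro d
    obtain ⟨θ₀, hθ₀⟩ := exists_lt_of_lt_ciSup
      (show (⨆ θ, R d θ) - ε / 2 < ⨆ θ, R d θ by linarith)
    obtain ⟨y, hy, hdist⟩ := Set.mem_iUnion₂.1 (htc (Set.mem_univ θ₀))
    refine ⟨⟨y, hy⟩, ?_⟩
    have h1 := ciInf_le hbelow d
    have h2 := (le_abs_self _).trans ((hLip d).dist_le_mul θ₀ y)
    have h3 : (k : ℝ) * dist θ₀ y ≤ ε / 2 := by
      calc (k : ℝ) * dist θ₀ y ≤ (k + 1) * (ε / (2 * (k + 1))) := by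
            gcongr
            · linarith
            · exact (Metric.mem_ball.1 hdist).le
        _ = ε / 2 := by field_simp
    change (⨅ d, ⨆ θ, R d θ) - ε ≤ R d y
    linarith
  obtain ⟨w, ⟨hw0, hw1⟩, hw⟩ := exists_mem_stdSimplex_forall_le_sum
    (V := LinearMap.funLeft ℝ ℝ ((↑) : t → Θ) '' Set.range R)
    (hconv.linear_image _) ((Set.range_nonempty R).image _)
    (c := (⨅ d, ⨆ θ, R d θ) - ε) (by
      rintro _ ⟨_, ⟨d, rfl⟩, rfl⟩
      exact hkey d)
  let w' : Θ → ENNReal := fun θ => if h : θ ∈ t then ENNReal.ofReal (w ⟨θ, h⟩) else 0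
  have hw' : ∀ i : t, w' i = ENNReal.ofReal (w i) := fun i => by simp [w']
  refine ⟨∑ θ ∈ t, w' θ • Measure.dirac θ, ⟨?_⟩, ⟨t, w', rfl⟩, fun d => ?_⟩
  · simp only [Measure.coe_finsetSum, Finset.sum_apply, Measure.smul_apply, measure_univ,
      smul_eq_mul, mul_one]
    rw [← Finset.sum_coe_sort, Finset.sum_congr rfl fun i _ => hw' i,
      ← ENNReal.ofReal_sum_of_nonneg fun i _ => hw0 i, hw1, ENNReal.ofReal_one]
  · have hint : ∀ θ ∈ t, Integrable (R d) (w' θ • Measure.dirac θ) := fun θ hθ =>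
      (integrable_dirac (by finiteness)).smul_measure (by simp [w', hθ])
    rw [integral_finsetSum_measure hint, ← Finset.sum_coe_sort]
    refine (hw _ ⟨_, ⟨d, rfl⟩, rfl⟩).trans_eq (Finset.sum_congr rfl fun i _ => ?_)
    rw [integral_smul_measure, integral_dirac, hw', ENNReal.toReal_ofReal (hw0 i), smul_eq_mul]
    rfl

/-- The pointwise mixture `a • κ + b • η` of two kernels. -/
noncomputable def ProbabilityTheory.Kernel.mix {X A : Type*} [MeasurableSpace X]
    [MeasurableSpace A] (a b : ENNReal) (κ η : Kernel X A) : Kernel X A where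
  toFun x := a • κ x + b • η x
  measurable' := by
    refine Measure.measurable_of_measurable_coe _ fun s hs => ?_
    simp only [Measure.add_apply, Measure.smul_apply, smul_eq_mul]
    exact ((κ.measurable_coe hs).const_mul a).add ((η.measurable_coe hs).const_mul b)

theorem ProbabilityTheory.Kernel.mix_apply {X A : Type*} [MeasurableSpace X]
    [MeasurableSpace A] (a b : ENNReal) (κ η : Kernel X A) (x : X) :
    κ.mix a b η x = a • κ x + b • η x := rfl

theorem ProbabilityTheory.Kernel.isMarkovKernel_mix {X A : Type*} [MeasurableSpace X]
    [MeasurableSpace A] {a b : ENNReal} (hab : a + b = 1) (κ η : Kernel X A) [IsMarkovKernel κ]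
    [IsMarkovKernel η] : IsMarkovKernel (κ.mix a b η) :=
  ⟨fun x => ⟨by simp [Kernel.mix_apply, hab]⟩⟩

theorem risk_mix {Θ X A : Type*} [MeasurableSpace X] [MeasurableSpace A]
    {ℓ : Θ → A → NNReal} (P : Θ → Measure X) (a b : ENNReal) (κ η : Kernel X A) {θ : Θ}
    (hℓ : Measurable (ℓ θ)) :
    risk ℓ P (κ.mix a b η) θ = a * risk ℓ P κ θ + b * risk ℓ P η θ := by
  have hm : ∀ κ : Kernel X A, Measurable fun x => ∫⁻ y, (ℓ θ y : ENNReal) ∂(κ x) :=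
    fun κ => hℓ.coe_nnreal_ennreal.lintegral_kernel
  simp only [risk, Kernel.mix_apply, lintegral_add_measure, lintegral_smul_measure, smul_eq_mul]
  rw [lintegral_add_left ((hm κ).const_mul a), lintegral_const_mul _ (hm κ),
    lintegral_const_mul _ (hm η)]

/-- The set of risk functions of randomized procedures is convex. -/
theorem convex_range_risk {Θ X A : Type*} [MeasurableSpace X] [MeasurableSpace A]
    {ℓ : Θ → A → NNReal} (hℓ : ∀ θ : Θ, Measurable (ℓ θ)) (P : Θ → Measure X)
    (hfin : ∀ δ : Kernel X A, IsMarkovKernel δ → ∀ θ : Θ, risk ℓ P δ θ ≠ ⊤) :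
    Convex ℝ (Set.range fun (δ : {δ : Kernel X A // IsMarkovKernel δ}) (θ : Θ) =>
      (risk ℓ P δ.1 θ).toReal) := by
  rintro _ ⟨⟨κ, hκ⟩, rfl⟩ _ ⟨⟨η, hη⟩, rfl⟩ a b ha hb hab
  have hab' : ENNReal.ofReal a + ENNReal.ofReal b = 1 := by
    rw [← ENNReal.ofReal_add ha hb, hab, ENNReal.ofReal_one]
  refine ⟨⟨κ.mix (ENNReal.ofReal a) (ENNReal.ofReal b) η, Kernel.isMarkovKernel_mix hab' κ η⟩, ?_⟩
  funext θ
  simp only [risk_mix P _ _ κ η (hℓ θ), Pi.add_apply, Pi.smul_apply, smul_eq_mul]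
  rw [ENNReal.toReal_add (ENNReal.mul_ne_top ENNReal.ofReal_ne_top (hfin κ hκ θ))
    (ENNReal.mul_ne_top ENNReal.ofReal_ne_top (hfin η hη θ)), ENNReal.toReal_mul,
    ENNReal.toReal_mul, ENNReal.toReal_ofReal ha, ENNReal.toReal_ofReal hb]

/-- On a totally bounded metric parameter space with uniformly Lipschitz real-valued risk
functions, there is a sequence of finitely supported priors whose Bayes maximin values
converge to the minimax value. -/
theorem stmt13 {Θ X A : Type*} [MetricSpace Θ] [Nonempty Θ] [Nonempty A]
    [MeasurableSpace Θ] [BorelSpace Θ] [MeasurableSpace X] [MeasurableSpace A]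
    (hΘ : TotallyBounded (Set.univ : Set Θ))
    (ℓ : Θ → A → NNReal) (hℓ : ∀ θ : Θ, Measurable (ℓ θ))
    (P : Θ → Measure X) (hP : ∀ θ : Θ, IsProbabilityMeasure (P θ))
    (k : NNReal)
    (hfin : ∀ δ : Kernel X A, IsMarkovKernel δ → ∀ θ : Θ, risk ℓ P δ θ ≠ ⊤)
    (hLip : ∀ δ : Kernel X A, IsMarkovKernel δ →
      LipschitzWith k (fun θ : Θ => (risk ℓ P δ θ).toReal)) :
    ∃ π : ℕ → Measure Θ,
      (∀ n, IsProbabilityMeasure (π n)) ∧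
      (∀ n, ∃ s : Finset Θ, ∃ w : Θ → ENNReal,
        π n = ∑ θ ∈ s, w θ • Measure.dirac θ) ∧
      Tendsto
        (fun n => ⨅ δ : {δ : Kernel X A // IsMarkovKernel δ},
          ∫ θ, (risk ℓ P δ.1 θ).toReal ∂(π n))
        atTop
        (nhds (⨅ δ : {δ : Kernel X A // IsMarkovKernel δ},
          ⨆ θ : Θ, (risk ℓ P δ.1 θ).toReal)) := by
  have hD : Nonempty {δ : Kernel X A // IsMarkovKernel δ} :=
    ⟨⟨Kernel.const X (Measure.dirac (Classical.arbitrary A)), inferInstance⟩⟩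
  have hnonneg : ∀ (δ : {δ : Kernel X A // IsMarkovKernel δ}) (θ : Θ),
      0 ≤ (risk ℓ P δ.1 θ).toReal := fun _ _ => ENNReal.toReal_nonneg
  choose π hπ hsupp hle using fun n : ℕ =>
    exists_finite_prior_sub_le hΘ k
      (fun (δ : {δ : Kernel X A // IsMarkovKernel δ}) (θ : Θ) => (risk ℓ P δ.1 θ).toReal)
      hnonneg (fun δ => hLip δ.1 δ.2) (convex_range_risk hℓ P hfin)
      (Nat.one_div_pos_of_nat (α := ℝ) (n := n))
  refine ⟨π, hπ, hsupp, ?_⟩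
  refine tendsto_of_tendsto_of_tendsto_of_le_of_le (h := fun _ => _) ?_ tendsto_const_nhds
    (fun n => le_ciInf (hle n)) fun n => ?_
  · simpa using tendsto_const_nhds.sub (tendsto_one_div_add_atTop_nhds_zero_nat (𝕜 := ℝ))
  · refine ciInf_mono ⟨0, ?_⟩ fun δ => ?_
    · rintro _ ⟨δ, rfl⟩
      exact integral_nonneg (hnonneg δ)
    · have hb := (hLip δ.1 δ.2).bddAbove_range_of_totallyBounded hΘ
      calc ∫ θ, (risk ℓ P δ.1 θ).toReal ∂(π n)
          ≤ ∫ _, (⨆ θ : Θ, (risk ℓ P δ.1 θ).toReal) ∂(π n) :=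
            integral_mono_of_nonneg (Eventually.of_forall (hnonneg δ)) (integrable_const _)
              (Eventually.of_forall (le_ciSup hb))
        _ = _ := by simp
end
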